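/- arXiv:1301.2841 — 2 statements merged into one kernel-verified Lean document; each statement's English description precedes it below -/
import Mathlib

section
/- Suppose p = p(n) is such that d = d(n) = p(n−1) ≥ log³n. Then there exists a constant c > 0 such that a.a.s. the random graph G ∈ G(n,p) satisfies: for every nonempty set S ⊆ [n] of s = |S| vertices and every natural number r, |⋃_{v∈S} N(v,r)| ≥ c·min{s·d^r, n}. -/
open MeasureTheory

/-- The Erdős–Rényi random graph measure: product over unordered pairs of distinct
vertices of Bernoulli(p) measures on `{0,1} ≅ Bool`. -/
noncomputable def gnp (n : ℕ) (p : ℝ) :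
    Measure ({e : Sym2 (Fin n) // ¬ e.IsDiag} → Bool) :=
  Measure.pi fun _ => (PMF.bernoulli (min (Real.toNNReal p) 1) (min_le_right _ _)).toMeasure

/-- The simple graph determined coordinatewise by a point of the product space. -/
def graphOf {n : ℕ} (ω : {e : Sym2 (Fin n) // ¬ e.IsDiag} → Bool) : SimpleGraph (Fin n) :=
  SimpleGraph.fromEdgeSet {e | ∃ h : ¬ e.IsDiag, ω ⟨e, h⟩ = true}

/-- `N(v,r)`: vertices joined to `v` by a path of length at most `r`. -/
def ball {n : ℕ} (G : SimpleGraph (Fin n)) (v : Fin n) (r : ℕ) : Set (Fin n) :=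
  {w | ∃ p : G.Walk v w, p.length ≤ r}


/-- The effective edge probability. -/
noncomputable def effp (p : ℝ) : ℝ := min (max p 0) 1

lemma effp_nonneg (p : ℝ) : 0 ≤ effp p := le_min (le_max_right _ _) zero_le_one

lemma effp_le_one (p : ℝ) : effp p ≤ 1 := min_le_right _ _

instance gnp_isProb (n : ℕ) (p : ℝ) : IsProbabilityMeasure (gnp n p) := by
  unfold gnp; infer_instance

open Classical in
/-- Indicator that the pair `e` is not an edge. -/
noncomputable def nonEdge {n : ℕ} (ω : {e : Sym2 (Fin n) // ¬ e.IsDiag} → Bool)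
    (e : Sym2 (Fin n)) : ℝ :=
  if ∃ h : ¬ e.IsDiag, ω ⟨e, h⟩ = true then 0 else 1

lemma integral_bern (p : ℝ) :
    ∫ b : Bool, (if b = true then (0:ℝ) else 1)
      ∂(PMF.bernoulli (min (Real.toNNReal p) 1) (min_le_right _ _)).toMeasure = 1 - effp p := by
  rw [PMF.integral_eq_sum]
  simp only [Fintype.sum_bool, PMF.bernoulli_apply, cond_true, cond_false, ENNReal.coe_toReal]
  rw [NNReal.coe_sub (min_le_right _ _)]
  simp [effp]

open Classical in
lemma integral_prod_nonEdge {n : ℕ} (p : ℝ) (F : Finset (Sym2 (Fin n)))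
    (hF : ∀ e ∈ F, ¬ e.IsDiag) :
    ∫ ω, ∏ e ∈ F, nonEdge ω e ∂(gnp n p) = (1 - effp p) ^ F.card := by
  have h1 : ∀ ω : {e : Sym2 (Fin n) // ¬ e.IsDiag} → Bool, ∏ e ∈ F, nonEdge ω e
      = ∏ e : {e : Sym2 (Fin n) // ¬ e.IsDiag},
        (fun b : Bool => if e.1 ∈ F then (if b = true then (0:ℝ) else 1) else 1) (ω e) := by
    intro ω
    rw [← Finset.prod_subtype_of_mem (fun e => nonEdge ω e) hF]
    rw [← Finset.prod_subset (Finset.subset_univ (Finset.subtype (fun e => ¬ e.IsDiag) F))]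
    · apply Finset.prod_congr rfl
      intro e he
      rw [Finset.mem_subtype] at he
      have : (∃ h : ¬ e.1.IsDiag, ω ⟨e.1, h⟩ = true) ↔ ω e = true :=
        ⟨fun ⟨_, h⟩ => h, fun h => ⟨e.2, h⟩⟩
      simp only [nonEdge, this, he, if_true]
    · intro e _ he
      rw [Finset.mem_subtype] at he
      simp [he]
  simp_rw [h1]
  unfold gnp
  rw [integral_fintype_prod_eq_prod (fun (e : {e : Sym2 (Fin n) // ¬ e.IsDiag}) (b : Bool) =>
    if e.1 ∈ F then (if b = true then (0:ℝ) else 1) else 1)]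
  have h2 : ∀ e : {e : Sym2 (Fin n) // ¬ e.IsDiag},
      ∫ b : Bool, (if e.1 ∈ F then (if b = true then (0:ℝ) else 1) else 1)
        ∂(PMF.bernoulli (min (Real.toNNReal p) 1) (min_le_right _ _)).toMeasure
      = if e.1 ∈ F then 1 - effp p else 1 := by
    intro e
    split_ifs with h
    · exact integral_bern p
    · rw [integral_const, probReal_univ]; simp
  simp_rw [h2]
  rw [← Finset.prod_subset (Finset.subset_univ (Finset.subtype (fun e => ¬ e.IsDiag) F))]
  · rw [Finset.prod_subtype_of_mem (fun e => if e ∈ F then 1 - effp p else 1) hF]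
    rw [Finset.prod_congr rfl (fun e he => if_pos he), Finset.prod_const]
  · intro e _ he
    rw [Finset.mem_subtype] at he
    simp [he]

open Classical in
lemma integral_block {n : ℕ} (p : ℝ) (A W : Finset (Fin n)) (hAW : Disjoint A W) :
    ∫ ω, ∏ w ∈ W, ∏ u ∈ A, nonEdge ω s(u, w) ∂(gnp n p)
      = ((1 - effp p) ^ A.card) ^ W.card := by
  have hd : ∀ a ∈ A, a ∉ W := fun a ha hw => Finset.disjoint_left.mp hAW ha hw
  have hinj : Set.InjOn (fun x : Fin n × Fin n => s(x.2, x.1)) ↑(W ×ˢ A) := by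
    rintro ⟨w, u⟩ h1 ⟨w', u'⟩ h2 h
    simp only [Finset.coe_product, Set.mem_prod, Finset.mem_coe] at h1 h2
    simp only [Sym2.eq_iff] at h
    rcases h with ⟨rfl, rfl⟩ | ⟨rfl, rfl⟩
    · rfl
    · exact absurd h1.1 (hd _ h2.2)
  have := integral_prod_nonEdge p ((W ×ˢ A).image (fun x : Fin n × Fin n => s(x.2, x.1))) (by
    intro e he
    rw [Finset.mem_image] at he
    obtain ⟨⟨w, u⟩, h, rfl⟩ := he
    rw [Finset.mem_product] at h
    simp only [Sym2.mk_isDiag_iff]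
    rintro rfl
    exact hd _ h.2 h.1)
  rw [Finset.card_image_of_injOn hinj, Finset.card_product, mul_comm, pow_mul] at this
  rw [← this]
  congr 1
  ext ω
  rw [Finset.prod_image hinj, Finset.prod_product]

open Classical in
lemma integral_mgf {n : ℕ} (p : ℝ) (A W : Finset (Fin n)) (hAW : Disjoint A W) (α β : ℝ) :
    ∫ ω, ∏ w ∈ W, (β * ∏ u ∈ A, nonEdge ω s(u, w) + α) ∂(gnp n p)
      = (β * (1 - effp p) ^ A.card + α) ^ W.card := by
  have hR : (β * (1 - effp p) ^ A.card + α) ^ W.card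
      = ∏ w ∈ W, (β * (1 - effp p) ^ A.card + α) := by rw [Finset.prod_const]
  rw [hR]
  simp_rw [Finset.prod_add]
  rw [integral_finsetSum _ (fun _ _ => Integrable.of_finite)]
  apply Finset.sum_congr rfl
  intro T hT
  rw [Finset.mem_powerset] at hT
  rw [integral_mul_const]
  congr 1
  simp_rw [Finset.prod_mul_distrib]
  rw [integral_const_mul, integral_block p A T (Finset.disjoint_of_subset_right hT hAW)]
  simp

open Classical in
/-- Closed neighbourhood. -/
noncomputable def cnb {n : ℕ} (G : SimpleGraph (Fin n)) (A : Finset (Fin n)) : Finset (Fin n) :=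
  Finset.univ.filter (fun w => w ∈ A ∨ ∃ u ∈ A, G.Adj u w)

lemma exp_neg_le_quad {x : ℝ} (hx : 0 ≤ x) : Real.exp (-x) ≤ 1 - x + x ^ 2 / 2 := by
  have h := Real.quadratic_le_exp_of_nonneg hx
  rw [Real.exp_neg]
  apply inv_le_of_inv_le₀ (by nlinarith [sq_nonneg (x - 1)])
  refine le_trans ?_ h
  apply inv_le_of_inv_le₀ (by positivity)
  rw [inv_le_iff_one_le_mul₀ (by positivity)]
  nlinarith [sq_nonneg (x ^ 2)]

open Classical in
lemma factor_eq {n : ℕ} (ω : {e : Sym2 (Fin n) // ¬ e.IsDiag} → Bool) (A : Finset (Fin n))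
    (w : Fin n) (hw : w ∉ A) (α : ℝ) :
    (1 - α) * ∏ u ∈ A, nonEdge ω s(u, w) + α
      = if ∃ u ∈ A, (graphOf ω).Adj u w then α else 1 := by
  split_ifs with h
  · obtain ⟨u, hu, hadj⟩ := h
    simp only [graphOf, SimpleGraph.fromEdgeSet_adj, Set.mem_setOf_eq] at hadj
    rw [Finset.prod_eq_zero hu (by simp only [nonEdge]; exact if_pos hadj.1)]
    simp
  · rw [Finset.prod_eq_one]
    · ring
    · intro u hu
      simp only [nonEdge]
      rw [if_neg]
      intro hx
      apply h
      refine ⟨u, hu, ?_⟩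
      simp only [graphOf, SimpleGraph.fromEdgeSet_adj, Set.mem_setOf_eq]
      exact ⟨hx, fun h => hw (h ▸ hu)⟩

open Classical in
lemma chernoff {n : ℕ} (p : ℝ) (A : Finset (Fin n)) (μ ε : ℝ) (hε : 0 ≤ ε)
    (hμ0 : 0 ≤ μ)
    (hμ : μ ≤ ((n : ℝ) - A.card) * (1 - (1 - effp p) ^ A.card)) :
    (gnp n p).real {ω | ((cnb (graphOf ω) A).card : ℝ) < (1 - ε) * μ}
      ≤ Real.exp (-(ε ^ 2 * μ / 2)) := by
  set f : ({e : Sym2 (Fin n) // ¬ e.IsDiag} → Bool) → ℝ := fun ω =>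
    ∏ w ∈ Aᶜ, ((1 - Real.exp (-ε)) * ∏ u ∈ A, nonEdge ω s(u, w) + Real.exp (-ε)) with hf
  have hfe : ∀ ω, f ω = Real.exp (-ε) ^
      (Finset.filter (fun w => ∃ u ∈ A, (graphOf ω).Adj u w) Aᶜ).card := by
    intro ω
    rw [hf]
    simp only
    rw [Finset.prod_congr rfl (fun w hw => factor_eq ω A w (Finset.mem_compl.mp hw) _)]
    rw [Finset.prod_ite]
    simp
  have hsub : {ω | ((cnb (graphOf ω) A).card : ℝ) < (1 - ε) * μ}
      ⊆ {ω | Real.exp (-ε * ((1 - ε) * μ)) ≤ f ω} := by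
    intro ω hω
    simp only [Set.mem_setOf_eq] at hω ⊢
    rw [hfe, ← Real.exp_nat_mul]
    apply Real.exp_le_exp.mpr
    have : ((Finset.filter (fun w => ∃ u ∈ A, (graphOf ω).Adj u w) Aᶜ).card : ℝ)
        ≤ (cnb (graphOf ω) A).card := by
      norm_cast
      apply Finset.card_le_card
      intro w hw
      simp only [Finset.mem_filter, cnb, Finset.mem_univ, true_and] at hw ⊢
      exact Or.inr hw.2
    nlinarith
  have hmk := mul_meas_ge_le_integral_of_nonneg (μ := gnp n p) (f := f)
    (Filter.Eventually.of_forall (fun ω => by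
      rw [hfe]; simp only [Pi.zero_apply]; positivity)) Integrable.of_finite (Real.exp (-ε * ((1 - ε) * μ)))
  rw [hf, integral_mgf p A Aᶜ disjoint_compl_right] at hmk
  rw [← hf] at hmk
  have hcard : ((Aᶜ.card : ℕ) : ℝ) = (n : ℝ) - A.card := by
    rw [Finset.card_compl, Fintype.card_fin, Nat.cast_sub]
    simpa using Finset.card_le_univ A
  set Q := (1 - effp p) ^ A.card with hQ
  have hQ0 : 0 ≤ Q := pow_nonneg (by linarith [effp_le_one p]) _
  have hQ1 : Q ≤ 1 := pow_le_one₀ (by linarith [effp_le_one p]) (by linarith [effp_nonneg p])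
  have hee : Real.exp (-ε) ≤ 1 := by rw [Real.exp_le_one_iff]; linarith
  have hquad := exp_neg_le_quad hε
  have hb : ((1 - Real.exp (-ε)) * Q + Real.exp (-ε)) ^ Aᶜ.card
      ≤ Real.exp (-(μ * (ε - ε ^ 2 / 2))) := by
    calc ((1 - Real.exp (-ε)) * Q + Real.exp (-ε)) ^ Aᶜ.card
        ≤ (Real.exp (-((1 - Q) * (1 - Real.exp (-ε))))) ^ Aᶜ.card := by
          apply pow_le_pow_left₀
          · have := Real.exp_pos (-ε)
            have : 0 ≤ (1 - Real.exp (-ε)) * Q := mul_nonneg (by linarith) hQ0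
            linarith
          · refine le_trans (le_of_eq ?_) (Real.one_sub_le_exp_neg _)
            ring
      _ = Real.exp (-((((n:ℝ) - A.card) * (1 - Q)) * (1 - Real.exp (-ε)))) := by
          rw [← Real.exp_nat_mul, hcard]; congr 1; ring
      _ ≤ Real.exp (-(μ * (ε - ε ^ 2 / 2))) := by
          apply Real.exp_le_exp.mpr
          apply neg_le_neg
          calc μ * (ε - ε ^ 2 / 2) ≤ μ * (1 - Real.exp (-ε)) :=
                mul_le_mul_of_nonneg_left (by linarith) hμ0
            _ ≤ _ := mul_le_mul_of_nonneg_right hμ (by linarith)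
  have h3 : (gnp n p).real {ω | ((cnb (graphOf ω) A).card : ℝ) < (1 - ε) * μ}
      ≤ (gnp n p).real {ω | Real.exp (-ε * ((1 - ε) * μ)) ≤ f ω} := measureReal_mono hsub
  refine h3.trans ?_
  have h4 := hmk.trans hb
  have h5 : Real.exp (-(μ * (ε - ε ^ 2 / 2))) =
      Real.exp (-ε * ((1 - ε) * μ)) * Real.exp (-(ε ^ 2 * μ / 2)) := by
    rw [← Real.exp_add]; congr 1; ring
  rw [h5] at h4
  exact le_of_mul_le_mul_left h4 (Real.exp_pos _)

lemma q_lower (p : ℝ) (a : ℕ) (y : ℝ) (hy0 : 0 ≤ y) (hy : y ≤ a * effp p) :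
    y - y ^ 2 / 2 ≤ 1 - (1 - effp p) ^ a := by
  have h1 : (1 - effp p) ^ a ≤ Real.exp (-y) := by
    calc (1 - effp p) ^ a ≤ (Real.exp (-effp p)) ^ a :=
          pow_le_pow_left₀ (by linarith [effp_le_one p]) (Real.one_sub_le_exp_neg _) _
      _ = Real.exp (-(a * effp p)) := by rw [← Real.exp_nat_mul]; congr 1; ring
      _ ≤ _ := Real.exp_le_exp.mpr (by linarith)
  have := exp_neg_le_quad hy0
  linarith

set_option maxHeartbeats 2000000 in
lemma sharp_bound {n : ℕ} (p L d : ℝ) (hL : 1000 ≤ L) (hnL : L ^ 3 ≤ n)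
    (hdd : d = p * ((n : ℝ) - 1)) (hd : L ^ 3 ≤ d) (A : Finset (Fin n)) (hA : A.Nonempty)
    (hAd : A.card * d ≤ n / L) :
    (gnp n p).real {ω | ((cnb (graphOf ω) A).card : ℝ) < (1 - 5 / L) * (A.card * d)}
      ≤ Real.exp (-(2 * A.card * L)) := by
  have ha1 : (1 : ℝ) ≤ A.card := by exact_mod_cast hA.card_pos
  set a : ℝ := (A.card : ℝ) with ha
  have hL0 : 0 < L := by linarith
  have hL3 : (1000:ℝ) ≤ L ^ 3 := by nlinarith [sq_nonneg L, mul_self_nonneg (L-1)]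
  have hn : (1000 : ℝ) ≤ n := by linarith
  have hd0 : 0 < d := by linarith
  have hp0 : 0 < p := by
    by_contra h
    push Not at h
    have : p * ((n:ℝ) - 1) ≤ 0 := mul_nonpos_of_nonpos_of_nonneg h (by linarith)
    linarith
  have hAdL : a * d * L ≤ n := by rwa [le_div_iff₀ hL0] at hAd
  have hda : d ≤ a * d := by nlinarith
  have hadp : 0 < a * d := by positivity
  have hdn : d ≤ n - 1 := by nlinarith
  have hp1 : p ≤ 1 := by
    by_contra h
    push Not at h
    nlinarith
  have heff : effp p = p := by
    unfold effp
    rw [max_eq_left hp0.le, min_eq_left hp1]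
  set i : ℝ := 1 / L with hi
  have hiL : i * L = 1 := by rw [hi]; field_simp
  have hi0 : 0 < i := by positivity
  have hi1 : i ≤ 1 / 1000 := one_div_le_one_div_of_le (by norm_num) hL
  have hx : a * p ≤ 2 * i := by
    have h1 : a * p * ((n:ℝ) - 1) * L ≤ n := by
      have : a * p * ((n:ℝ) - 1) = a * d := by rw [hdd]; ring
      rw [this]; exact hAdL
    have h2 : a * p * L ≤ 2 := by
      by_contra h
      push Not at h
      nlinarith
    calc a * p = (a * p * L) * i := by rw [mul_assoc, mul_comm L, hiL, mul_one]
      _ ≤ 2 * i := mul_le_mul_of_nonneg_right h2 hi0.le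
  have han : a ≤ i * n := by
    have h1 : a * L ≤ n := by nlinarith
    calc a = (a * L) * i := by rw [mul_assoc, mul_comm L, hiL, mul_one]
      _ ≤ n * i := mul_le_mul_of_nonneg_right h1 hi0.le
      _ = i * n := mul_comm _ _
  have hq := q_lower p A.card (a * p) (by positivity) (by rw [heff])
  have hap : 0 < a * p := by positivity
  have hq2 : a * p * (1 - i) ≤ 1 - (1 - effp p) ^ A.card := by
    refine le_trans ?_ hq
    nlinarith
  have hμ : a * d * (1 - i) ^ 2 ≤ ((n:ℝ) - A.card) * (1 - (1 - effp p) ^ A.card) := by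
    calc a * d * (1 - i) ^ 2 = (((n:ℝ) - 1) * (1 - i)) * (a * p * (1 - i)) := by rw [hdd]; ring
      _ ≤ ((n:ℝ) - A.card) * (1 - (1 - effp p) ^ A.card) := by
        apply mul_le_mul _ hq2 _ _
        · rw [← ha]; nlinarith
        · apply mul_nonneg hap.le; linarith
        · rw [← ha]; nlinarith
  have hc := chernoff p A (a * d * (1 - i) ^ 2) (3 * i) (by positivity) (by positivity) hμ
  have hsub : {ω : {e : Sym2 (Fin n) // ¬ e.IsDiag} → Bool |
        ((cnb (graphOf ω) A).card : ℝ) < (1 - 5 / L) * (a * d)}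
      ⊆ {ω | ((cnb (graphOf ω) A).card : ℝ) < (1 - 3 * i) * (a * d * (1 - i) ^ 2)} := by
    intro ω hω
    simp only [Set.mem_setOf_eq] at hω ⊢
    refine lt_of_lt_of_le hω ?_
    have h5 : (5:ℝ) / L = 5 * i := by rw [hi]; ring
    rw [h5]
    have h50 : 0 ≤ i * i * (7 - 3 * i) := mul_nonneg (mul_self_nonneg i) (by linarith)
    have h51 : 1 - 5 * i ≤ (1 - 3 * i) * (1 - i) ^ 2 := by linarith
    calc (1 - 5 * i) * (a * d) ≤ ((1 - 3 * i) * (1 - i) ^ 2) * (a * d) :=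
          mul_le_mul_of_nonneg_right h51 hadp.le
      _ = _ := by ring
  refine (measureReal_mono hsub).trans (hc.trans ?_)
  apply Real.exp_le_exp.mpr
  apply neg_le_neg
  have h6 : a * L ≤ i ^ 2 * (a * d) := by
    calc a * L = i ^ 2 * (a * L ^ 3) := by
          have : i ^ 2 * L ^ 2 = 1 := by rw [← mul_pow, hiL, one_pow]
          linear_combination (-(a * L)) * this
      _ ≤ _ := by gcongr
  have h7 : (4:ℝ) / 9 ≤ (1 - i) ^ 2 := by nlinarith
  have h8 : 0 < a * L := by positivity
  calc 2 * a * L = 9 / 2 * (4 / 9) * (a * L) := by ring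
    _ ≤ 9 / 2 * (1 - i) ^ 2 * (i ^ 2 * (a * d)) := by gcongr
    _ = _ := by ring

lemma rough_bound {n : ℕ} (p L d : ℝ) (hL : 1000 ≤ L) (hnL : L ^ 3 ≤ n)
    (hdd : d = p * ((n : ℝ) - 1)) (hd : L ^ 3 ≤ d) (A : Finset (Fin n)) (hA : A.Nonempty)
    (hAn : A.card * L ^ 2 ≤ n) :
    (gnp n p).real {ω | ((cnb (graphOf ω) A).card : ℝ) < min (A.card * d) ((n:ℝ) - 1) / 8}
      ≤ Real.exp (-(2 * A.card * L)) := by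
  have ha1 : (1 : ℝ) ≤ A.card := by exact_mod_cast hA.card_pos
  set a : ℝ := (A.card : ℝ) with ha
  have hL0 : 0 < L := by linarith
  have hL3 : (1000:ℝ) ≤ L ^ 3 := by nlinarith [sq_nonneg L, mul_self_nonneg (L-1)]
  have hn : (1000 : ℝ) ≤ n := by linarith
  have hd0 : 0 < d := by linarith
  have hp0 : 0 < p := by
    by_contra h
    push Not at h
    have : p * ((n:ℝ) - 1) ≤ 0 := mul_nonpos_of_nonpos_of_nonneg h (by linarith)
    linarith
  have haL : 1000 * (a * L) ≤ n := by
    have : 0 < a * L := by positivity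
    nlinarith
  have han : a * 1000 ≤ n := by nlinarith
  set y : ℝ := min (a * p) 1 with hy
  have hy0 : 0 ≤ y := le_min (by positivity) zero_le_one
  have hy1 : y ≤ 1 := min_le_right _ _
  have hye : y ≤ a * effp p := by
    unfold effp
    rw [max_eq_left hp0.le]
    rcases le_total p 1 with h | h
    · rw [min_eq_left h]; exact min_le_left _ _
    · rw [min_eq_right h]; linarith
  have hq := q_lower p A.card y hy0 hye
  have hq2 : y / 2 ≤ 1 - (1 - effp p) ^ A.card := by
    refine le_trans ?_ hq
    nlinarith
  have hm : min (a * d) ((n:ℝ) - 1) = ((n:ℝ) - 1) * y := by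
    rw [hy, mul_min_of_nonneg _ _ (by linarith : (0:ℝ) ≤ (n:ℝ) - 1), hdd, mul_one]
    congr 1; ring
  have hμ : min (a * d) ((n:ℝ) - 1) / 4 ≤ ((n:ℝ) - A.card) * (1 - (1 - effp p) ^ A.card) := by
    calc min (a * d) ((n:ℝ) - 1) / 4 = (((n:ℝ) - 1) / 2) * (y / 2) := by rw [hm]; ring
      _ ≤ _ := by
        apply mul_le_mul _ hq2 (by positivity)
        · rw [← ha]; nlinarith
        · rw [← ha]; nlinarith
  have hmp : 0 ≤ min (a * d) ((n:ℝ) - 1) := le_min (by positivity) (by linarith)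
  have hc := chernoff p A (min (a * d) ((n:ℝ) - 1) / 4) (1 / 2) (by norm_num) (by positivity) hμ
  have he : (1 - 1 / 2) * (min (a * d) ((n:ℝ) - 1) / 4) = min (a * d) ((n:ℝ) - 1) / 8 := by ring
  rw [he] at hc
  refine hc.trans ?_
  apply Real.exp_le_exp.mpr
  apply neg_le_neg
  have h9 : 64 * (a * L) ≤ min (a * d) ((n:ℝ) - 1) := by
    apply le_min
    · have : 64 * L ≤ d := by nlinarith [mul_self_nonneg (L-1)]
      nlinarith
    · nlinarith
  linarith

/-- The good expansion event. -/
def Good {n : ℕ} (L d : ℝ) (G : SimpleGraph (Fin n)) : Prop :=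
  ∀ A : Finset (Fin n), A.Nonempty →
    (A.card * d ≤ n / L → (1 - 5 / L) * (A.card * d) ≤ (cnb G A).card) ∧
    (A.card * L ^ 2 ≤ n → min (A.card * d) ((n:ℝ) - 1) / 8 ≤ (cnb G A).card)

lemma good_prob {n : ℕ} (p L d : ℝ) (hLn : L = Real.log n) (hL : 1000 ≤ L) (hnL : L ^ 3 ≤ n)
    (hdd : d = p * ((n : ℝ) - 1)) (hd : L ^ 3 ≤ d) :
    (gnp n p).real {ω | ¬ Good L d (graphOf ω)} ≤ 2 * (Real.exp (1 / n) - 1) := by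
  classical
  have hL3 : (1000:ℝ) ≤ L ^ 3 := by nlinarith [sq_nonneg L, mul_self_nonneg (L-1)]
  have hn : (1000 : ℝ) ≤ n := by linarith
  set B : Finset (Fin n) → Set ({e : Sym2 (Fin n) // ¬ e.IsDiag} → Bool) := fun A =>
    {ω | ¬ ((A.card * d ≤ n / L → (1 - 5 / L) * (A.card * d) ≤ (cnb (graphOf ω) A).card) ∧
    (A.card * L ^ 2 ≤ n → min (A.card * d) ((n:ℝ) - 1) / 8 ≤ (cnb (graphOf ω) A).card))} with hB
  set 𝒜 : Finset (Finset (Fin n)) := Finset.univ.erase ∅ with h𝒜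
  have hsub : {ω : {e : Sym2 (Fin n) // ¬ e.IsDiag} → Bool | ¬ Good L d (graphOf ω)}
      ⊆ ⋃ A ∈ 𝒜, B A := by
    intro ω hω
    simp only [Set.mem_setOf_eq, Good] at hω
    push Not at hω
    obtain ⟨A, hA, h⟩ := hω
    simp only [Set.mem_iUnion]
    refine ⟨A, by simp [h𝒜, hA.ne_empty], ?_⟩
    simp only [hB, Set.mem_setOf_eq, not_and]
    intro h1
    obtain ⟨h2, h3⟩ := h h1
    exact fun h4 => absurd (h4 h2) (not_le.mpr h3)
  have hone : ∀ A ∈ 𝒜, (gnp n p).real (B A) ≤ 2 * (Real.exp (-(2 * L))) ^ A.card := by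
    intro A hA
    have hA' : A.Nonempty := by
      rw [Finset.nonempty_iff_ne_empty]; exact (Finset.mem_erase.mp hA).1
    have hpow : (Real.exp (-(2 * L))) ^ A.card = Real.exp (-(2 * A.card * L)) := by
      rw [← Real.exp_nat_mul]; congr 1; ring
    rw [hpow]
    have hs : B A ⊆ {ω | A.card * d ≤ n / L ∧
          ((cnb (graphOf ω) A).card : ℝ) < (1 - 5 / L) * (A.card * d)} ∪
        {ω | A.card * L ^ 2 ≤ n ∧
          ((cnb (graphOf ω) A).card : ℝ) < min (A.card * d) ((n:ℝ) - 1) / 8} := by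
      intro ω hω
      simp only [hB, Set.mem_setOf_eq] at hω
      rw [not_and_or] at hω
      push Not at hω
      exact hω
    refine (measureReal_mono hs).trans ((measureReal_union_le _ _).trans ?_)
    rw [two_mul]
    apply add_le_add
    · by_cases h : A.card * d ≤ n / L
      · simp only [h, true_and]
        exact sharp_bound p L d hL hnL hdd hd A hA' h
      · simp only [h, false_and, Set.setOf_false, measureReal_empty]; positivity
    · by_cases h : A.card * L ^ 2 ≤ (n:ℝ)
      · simp only [h, true_and]
        exact rough_bound p L d hL hnL hdd hd A hA' h
      · simp only [h, false_and, Set.setOf_false, measureReal_empty]; positivity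
  refine (measureReal_mono hsub (measure_ne_top _ _)).trans ((measureReal_biUnion_finset_le _ _).trans ?_)
  refine (Finset.sum_le_sum hone).trans ?_
  rw [← Finset.mul_sum]
  gcongr
  set x := Real.exp (-(2 * L)) with hx
  have hsum : ∑ A : Finset (Fin n), x ^ A.card = (x + 1) ^ n := by
    have := Fintype.sum_pow_mul_eq_add_pow (Fin n) x 1
    simpa using this
  have hsum2 : ∑ A ∈ 𝒜, x ^ A.card = (x + 1) ^ n - 1 := by
    rw [← hsum, h𝒜, ← Finset.sum_erase_add _ _ (Finset.mem_univ (∅ : Finset (Fin n)))]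
    simp
  rw [hsum2]
  gcongr
  calc (x + 1) ^ n ≤ (Real.exp x) ^ n := by
        apply pow_le_pow_left₀ (by positivity) (Real.add_one_le_exp x)
    _ = Real.exp (n * x) := by rw [← Real.exp_nat_mul]
    _ = Real.exp (1 / n) := by
        congr 1
        have : x = 1 / (n:ℝ) ^ 2 := by
          rw [hx, hLn, Real.exp_neg, two_mul, Real.exp_add, Real.exp_log (by linarith), ← sq,
            one_div]
        rw [this]; field_simp

lemma subset_cnb {n : ℕ} (G : SimpleGraph (Fin n)) (A : Finset (Fin n)) : A ⊆ cnb G A := by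
  intro w hw
  simp only [cnb, Finset.mem_filter, Finset.mem_univ, true_and]
  exact Or.inl hw

lemma cnb_mono {n : ℕ} (G : SimpleGraph (Fin n)) {A B : Finset (Fin n)} (h : A ⊆ B) :
    cnb G A ⊆ cnb G B := by
  intro w hw
  simp only [cnb, Finset.mem_filter, Finset.mem_univ, true_and] at hw ⊢
  rcases hw with hw | ⟨u, hu, hadj⟩
  · exact Or.inl (h hw)
  · exact Or.inr ⟨u, h hu, hadj⟩

lemma iter_subset {n : ℕ} (G : SimpleGraph (Fin n)) (S : Finset (Fin n)) (r : ℕ) :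
    (((cnb G)^[r] S : Finset (Fin n)) : Set (Fin n)) ⊆ ⋃ v ∈ S, ball G v r := by
  induction r with
  | zero =>
    intro w hw
    simp only [Function.iterate_zero, id_eq, Finset.mem_coe] at hw
    simp only [Set.mem_iUnion]
    exact ⟨w, hw, SimpleGraph.Walk.nil, by simp⟩
  | succ r ih =>
    intro w hw
    rw [Function.iterate_succ_apply'] at hw
    simp only [cnb, Finset.coe_filter, Finset.mem_univ, true_and, Set.mem_setOf_eq] at hw
    simp only [Set.mem_iUnion]
    rcases hw with hw | ⟨u, hu, hadj⟩
    · have := ih (Finset.mem_coe.mpr hw)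
      simp only [Set.mem_iUnion] at this
      obtain ⟨v, hv, q, hq⟩ := this
      exact ⟨v, hv, q, by omega⟩
    · have := ih (Finset.mem_coe.mpr hu)
      simp only [Set.mem_iUnion] at this
      obtain ⟨v, hv, q, hq⟩ := this
      refine ⟨v, hv, q.concat hadj, ?_⟩
      rw [SimpleGraph.Walk.length_concat]; omega

lemma rough_all {n : ℕ} (L d : ℝ) (hL : 1000 ≤ L) (hnL : L ^ 3 ≤ n) (hd : L ^ 3 ≤ d)
    (G : SimpleGraph (Fin n)) (hG : Good L d G) (A : Finset (Fin n)) (hA : A.Nonempty) :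
    min (A.card * d) (n : ℝ) / 16 ≤ (cnb G A).card := by
  have hL3 : (1000:ℝ) ≤ L ^ 3 := by nlinarith [sq_nonneg L, mul_self_nonneg (L-1)]
  have hn : (1000 : ℝ) ≤ n := by linarith
  by_cases h : A.card * L ^ 2 ≤ (n:ℝ)
  · refine le_trans ?_ ((hG A hA).2 h)
    have h1 : min (A.card * d) (n:ℝ) ≤ 2 * min (A.card * d) ((n:ℝ) - 1) := by
      rw [mul_min_of_nonneg _ _ (by norm_num : (0:ℝ) ≤ 2)]
      apply min_le_min
      · have : 0 ≤ A.card * d := by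
          apply mul_nonneg (by positivity); linarith
        linarith
      · linarith
    linarith
  · push Not at h
    set m : ℕ := ⌊(n:ℝ) / L ^ 2⌋₊ with hm
    have hL2 : 0 < L ^ 2 := by positivity
    have hm1 : (m:ℝ) ≤ n / L ^ 2 := Nat.floor_le (by positivity)
    have hm2 : (n:ℝ) / L ^ 2 < m + 1 := Nat.lt_floor_add_one _
    rw [le_div_iff₀ hL2] at hm1
    rw [div_lt_iff₀ hL2] at hm2
    have hmA : m ≤ A.card := by
      have : (m:ℝ) < A.card := by
        by_contra hh
        push Not at hh
        nlinarith
      exact_mod_cast this.le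
    have hm0 : (1:ℝ) ≤ m := by
      have : 0 < m := by
        by_contra hh
        have h0 : m = 0 := by omega
        rw [h0] at hm2
        simp only [Nat.cast_zero, zero_add, one_mul] at hm2
        nlinarith
      exact_mod_cast this
    obtain ⟨A', hA'A, hA'c⟩ := Finset.exists_subset_card_eq hmA
    have hA' : A'.Nonempty := by
      rw [← Finset.card_pos, hA'c]; exact_mod_cast hm0
    have h2 := (hG A' hA').2 (by rw [hA'c]; exact hm1)
    rw [hA'c] at h2
    have h3 : (n:ℝ) - 1 ≤ m * d := by nlinarith
    rw [min_eq_right h3] at h2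
    have h4 : ((cnb G A').card : ℝ) ≤ (cnb G A).card := by
      exact_mod_cast Finset.card_le_card (cnb_mono G hA'A)
    have h5 := min_le_right (A.card * d) (n:ℝ)
    linarith

lemma growth {n : ℕ} (L d : ℝ) (hLn : L = Real.log n) (hL : 1000 ≤ L) (hnL : L ^ 3 ≤ n)
    (hd : L ^ 3 ≤ d)
    (G : SimpleGraph (Fin n)) (hG : Good L d G) (S : Finset (Fin n)) (hS : S.Nonempty) (r : ℕ) :
    Real.exp (-10) / 16 * min (S.card * d ^ r) (n : ℝ) ≤ ((cnb G)^[r] S).card := by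
  have hL3 : (1000:ℝ) ≤ L ^ 3 := by nlinarith [sq_nonneg L, mul_self_nonneg (L-1)]
  have hn : (1000 : ℝ) ≤ n := by linarith
  have hL0 : 0 < L := by linarith
  have hd0 : 0 < d := by linarith
  have hs1 : (1:ℝ) ≤ S.card := by exact_mod_cast hS.card_pos
  have hi0 : 0 < 5 / L := by positivity
  have hi1 : 5 / L ≤ 1 / 200 := by rw [div_le_div_iff₀ hL0 (by norm_num)]; linarith
  have he1 : Real.exp (-10) ≤ 1 := by rw [Real.exp_le_one_iff]; norm_num
  have he0 := Real.exp_pos (-10)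
  have hne : ∀ r, ((cnb G)^[r] S).Nonempty := by
    intro r
    induction r with
    | zero => simpa using hS
    | succ r ih => rw [Function.iterate_succ_apply']; exact ih.mono (subset_cnb G _)
  -- consequence of the first state
  have hstate : ∀ r : ℕ, (1 - 5 / L) ^ r * (S.card * d ^ r) ≤ (((cnb G)^[r] S).card : ℝ) →
      Real.exp (-10) * (S.card * d ^ r) ≤ (((cnb G)^[r] S).card : ℝ) := by
    intro r hr
    refine le_trans ?_ hr
    apply mul_le_mul_of_nonneg_right _ (by positivity)
    have hcn : (((cnb G)^[r] S).card : ℝ) ≤ n := by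
      have := Finset.card_le_univ ((cnb G)^[r] S)
      rw [Fintype.card_fin] at this
      exact_mod_cast this
    have h1 : (Real.exp 1) ^ r ≤ n := by
      calc (Real.exp 1) ^ r ≤ ((1 - 5 / L) * d) ^ r := by
            apply pow_le_pow_left₀ (Real.exp_pos _).le
            have := Real.exp_one_lt_d9
            nlinarith
        _ = (1 - 5 / L) ^ r * (1 * d ^ r) := by rw [mul_pow, one_mul]
        _ ≤ (1 - 5 / L) ^ r * (S.card * d ^ r) := by
            have : 0 ≤ 1 - 5 / L := by linarith
            gcongr
        _ ≤ n := hr.trans hcn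
    have h2 : (r:ℝ) ≤ L := by
      rw [← Real.exp_nat_mul, mul_one] at h1
      rw [hLn]
      exact (Real.le_log_iff_exp_le (by linarith)).mpr h1
    have h3 : Real.exp (-(2 * (5 / L))) ≤ 1 - 5 / L := by
      have := exp_neg_le_quad (x := 2 * (5 / L)) (by positivity)
      nlinarith
    calc Real.exp (-10) ≤ Real.exp (r * (-(2 * (5 / L)))) := by
          apply Real.exp_le_exp.mpr
          have : (r:ℝ) * (5 / L) ≤ 5 := by
            calc (r:ℝ) * (5 / L) ≤ L * (5 / L) := by gcongr
              _ = 5 := by field_simp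
          linarith
      _ = (Real.exp (-(2 * (5 / L)))) ^ r := by rw [← Real.exp_nat_mul]
      _ ≤ _ := pow_le_pow_left₀ (Real.exp_pos _).le h3 _
  have key : ∀ r : ℕ, (1 - 5 / L) ^ r * (S.card * d ^ r) ≤ (((cnb G)^[r] S).card : ℝ) ∨
      ((n:ℝ) / (16 * L) ≤ (((cnb G)^[r] S).card : ℝ) ∧
        Real.exp (-10) / 16 * min (S.card * d ^ r) (n : ℝ) ≤ (((cnb G)^[r] S).card : ℝ)) := by
    intro r
    induction r with
    | zero => left; simp
    | succ r ih =>
      rw [Function.iterate_succ_apply']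
      have hrough := rough_all L d hL hnL hd G hG _ (hne r)
      have hsharp := (hG _ (hne r)).1
      have hst := hstate r
      set a : ℝ := (((cnb G)^[r] S).card : ℝ) with ha
      set b : ℝ := ((cnb G ((cnb G)^[r] S)).card : ℝ) with hb
      have hbig : (n:ℝ) / L ≤ a * d → (n:ℝ) / (16 * L) ≤ b := by
        intro h
        refine le_trans ?_ hrough
        rw [div_le_div_iff₀ (by positivity) (by norm_num)]
        have h1 : (n:ℝ) / L ≤ min (a * d) n := by
          apply le_min h
          rw [div_le_iff₀ hL0]; nlinarith
        rw [div_le_iff₀ hL0] at h1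
        linarith
      rcases ih with h | ⟨h1, h2⟩
      · by_cases hc : a * d ≤ n / L
        · left
          refine le_trans ?_ (hsharp hc)
          calc (1 - 5 / L) ^ (r + 1) * (S.card * d ^ (r + 1))
              = (1 - 5 / L) * (((1 - 5 / L) ^ r * (S.card * d ^ r)) * d) := by ring
            _ ≤ _ := by
              have : 0 ≤ 1 - 5 / L := by linarith
              gcongr
        · right
          push Not at hc
          refine ⟨hbig hc.le, le_trans ?_ hrough⟩
          have h3 := hst h
          have h4 : Real.exp (-10) * min (S.card * d ^ (r + 1)) (n : ℝ) ≤ min (a * d) n := by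
            rw [mul_min_of_nonneg _ _ he0.le]
            apply min_le_min
            · calc Real.exp (-10) * (S.card * d ^ (r + 1))
                  = (Real.exp (-10) * (S.card * d ^ r)) * d := by ring
                _ ≤ _ := by gcongr
            · nlinarith
          linarith
      · right
        have h5 : (n:ℝ) ≤ a * d := by
          rw [div_le_iff₀ (by positivity)] at h1
          have h6 : 16 * L ≤ d := by nlinarith [mul_self_nonneg (L-1)]
          have : 0 ≤ a := by positivity
          nlinarith
        refine ⟨hbig (le_trans ?_ h5), le_trans ?_ hrough⟩
        · rw [div_le_iff₀ hL0]; nlinarith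
        · rw [min_eq_right h5]
          have := min_le_right (S.card * d ^ (r + 1)) (n:ℝ)
          have hh : 0 ≤ min (S.card * d ^ (r + 1)) (n:ℝ) := le_min (by positivity) (by positivity)
          nlinarith
  rcases key r with h | h
  · have h1 := hstate r h
    have h2 := min_le_left (S.card * d ^ r) (n:ℝ)
    have hh : 0 ≤ min (S.card * d ^ r) (n:ℝ) := le_min (by positivity) (by positivity)
    nlinarith
  · exact h.2

/-- If `d = p(n-1) ≥ log³ n`, then for some constant `c > 0`, a.a.s. in
`G(n,p)`: for every nonempty `S ⊆ [n]` with `|S| = s` and every `r : ℕ`,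
`|⋃_{v ∈ S} N(v,r)| ≥ c · min (s d^r) n`. -/
theorem stmt_8 (p : ℕ → ℝ)
    (hd : ∀ n : ℕ, 2 ≤ n → (Real.log n) ^ 3 ≤ p n * ((n : ℝ) - 1)) :
    ∃ c : ℝ, 0 < c ∧
      Filter.Tendsto (fun n : ℕ =>
          gnp n (p n) {ω | ∀ S : Finset (Fin n), S.Nonempty → ∀ r : ℕ,
            c * min ((S.card : ℝ) * (p n * ((n : ℝ) - 1)) ^ r) (n : ℝ)
              ≤ ((⋃ v ∈ S, ball (graphOf ω) v r).ncard : ℝ)})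
        Filter.atTop (nhds 1) := by
  refine ⟨Real.exp (-10) / 16, by positivity, ?_⟩
  have hlog : ∀ᶠ n : ℕ in Filter.atTop, 1000 ≤ Real.log n :=
    (Real.tendsto_log_atTop.comp tendsto_natCast_atTop_atTop).eventually_ge_atTop 1000
  have hlow : Filter.Tendsto (fun n : ℕ => ENNReal.ofReal (1 - 2 * (Real.exp (1 / n) - 1)))
      Filter.atTop (nhds 1) := by
    have h1 : Filter.Tendsto (fun n : ℕ => (1 - 2 * (Real.exp (1 / (n:ℝ)) - 1)))
        Filter.atTop (nhds (1 - 2 * (Real.exp 0 - 1))) := by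
      apply Filter.Tendsto.const_sub
      apply Filter.Tendsto.const_mul
      apply Filter.Tendsto.sub_const
      exact (Real.continuous_exp.tendsto 0).comp tendsto_one_div_atTop_nhds_zero_nat
    have h2 := ENNReal.tendsto_ofReal h1
    simpa using h2
  refine tendsto_of_tendsto_of_tendsto_of_le_of_le' hlow tendsto_const_nhds ?_
    (Filter.Eventually.of_forall (fun n => prob_le_one))
  filter_upwards [hlog, Filter.eventually_ge_atTop 2] with n hL hn2
  have hn0 : (0:ℝ) < n := by exact_mod_cast (by omega : 0 < n)
  have hnL : (Real.log n) ^ 3 ≤ n := by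
    have h1 := Real.pow_div_factorial_le_exp (Real.log n) (by linarith) 4
    rw [Real.exp_log hn0, div_le_iff₀ (by positivity)] at h1
    have h2 : ((4).factorial : ℝ) = 24 := by norm_num [Nat.factorial]
    rw [h2] at h1
    have h3 : 0 < (Real.log n) ^ 3 := by positivity
    have h4 : (Real.log n) ^ 4 = (Real.log n) ^ 3 * Real.log n := by ring
    rw [h4] at h1
    nlinarith
  have hgp := good_prob (p n) (Real.log n) (p n * ((n:ℝ) - 1)) rfl hL hnL rfl (hd n hn2)
  have hms : MeasurableSet {ω : {e : Sym2 (Fin n) // ¬ e.IsDiag} → Bool |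
    Good (Real.log n) (p n * ((n:ℝ) - 1)) (graphOf ω)} := Set.Finite.measurableSet (Set.toFinite _)
  have hcompl := probReal_compl_eq_one_sub (μ := gnp n (p n)) hms
  have hgood : 1 - 2 * (Real.exp (1 / n) - 1) ≤ (gnp n (p n)).real
      {ω | Good (Real.log n) (p n * ((n:ℝ) - 1)) (graphOf ω)} := by
    have : {ω : {e : Sym2 (Fin n) // ¬ e.IsDiag} → Bool |
      Good (Real.log n) (p n * ((n:ℝ) - 1)) (graphOf ω)}ᶜ = {ω |
      ¬ Good (Real.log n) (p n * ((n:ℝ) - 1)) (graphOf ω)} := rfl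
    rw [this] at hcompl
    linarith
  refine (ENNReal.ofReal_le_ofReal hgood).trans ?_
  rw [ofReal_measureReal]
  apply measure_mono
  intro ω hω S hS r
  refine (growth (Real.log n) _ rfl hL hnL (hd n hn2) (graphOf ω) hω S hS r).trans ?_
  rw [← Set.ncard_coe_finset]
  exact_mod_cast Set.ncard_le_ncard (iter_subset (graphOf ω) S r) (Set.toFinite _)
end

section
/- Suppose p = p(n) is such that d = d(n) = p(n−1) ≥ log³n. Then for every η ∈ (0,1), a.a.s. the random graph G ∈ G(n,p) satisfies: for every nonempty set S ⊆ [n] of s = |S| vertices and every natural number r with s·d^r < n/log n, (1−η)·s·d^r ≤ |⋃_{v∈S} N(v,r)| ≤ (1+η)·s·d^r. -/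
open MeasureTheory

theorem ball_zero {n : ℕ} (G : SimpleGraph (Fin n)) (v : Fin n) : ball G v 0 = {v} := by
  ext w
  simp only [ball, Set.mem_ofPred_eq, Set.mem_singleton_iff]
  constructor
  · rintro ⟨p, hp⟩
    exact (SimpleGraph.Walk.eq_of_length_eq_zero (by omega : p.length = 0)).symm
  · rintro rfl
    exact ⟨SimpleGraph.Walk.nil, by simp⟩

theorem mem_ball_succ {n : ℕ} (G : SimpleGraph (Fin n)) (v w : Fin n) (r : ℕ) :
    w ∈ ball G v (r+1) ↔ w ∈ ball G v r ∨ ∃ u ∈ ball G v r, G.Adj u w := by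
  simp only [ball, Set.mem_ofPred_eq]
  constructor
  · rintro ⟨p, hp⟩
    by_cases h : p.length ≤ r
    · exact Or.inl ⟨p, h⟩
    · right
      have hnn : ¬ p.Nil := by
        intro h0
        have := SimpleGraph.Walk.length_eq_zero_iff.mpr h0
        omega
      refine ⟨p.penultimate, ⟨p.dropLast, ?_⟩, p.adj_penultimate hnn⟩
      have := congrArg SimpleGraph.Walk.length (p.concat_dropLast (p.adj_penultimate hnn))
      rw [SimpleGraph.Walk.length_concat] at this
      omega
  · rintro (⟨p, hp⟩ | ⟨u, ⟨p, hp⟩, h⟩)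
    · exact ⟨p, by omega⟩
    · exact ⟨p.concat h, by rw [SimpleGraph.Walk.length_concat]; omega⟩

theorem union_ball {n : ℕ} (G : SimpleGraph (Fin n)) (S : Finset (Fin n)) (r : ℕ) :
    (⋃ v ∈ S, ball G v r) = (((cnb G)^[r] S : Finset (Fin n)) : Set (Fin n)) := by
  induction r with
  | zero => ext w; simp [ball_zero]
  | succ r ih =>
    rw [Function.iterate_succ_apply']
    ext w
    have ih' : ∀ w, w ∈ ((cnb G)^[r] S) ↔ ∃ v ∈ S, w ∈ ball G v r := by
      intro w
      rw [← Finset.mem_coe, ← ih]; simp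
    simp only [Set.mem_iUnion, mem_ball_succ, cnb, Finset.coe_filter, Finset.mem_univ, true_and,
      Set.mem_ofPred_eq, ih', exists_prop]
    constructor
    · rintro ⟨v, hv, h | ⟨u, hu, h⟩⟩
      · exact Or.inl ⟨v, hv, h⟩
      · exact Or.inr ⟨u, ⟨v, hv, hu⟩, h⟩
    · rintro (⟨v, hv, h⟩ | ⟨u, ⟨v, hv, hu⟩, h⟩)
      · exact ⟨v, hv, Or.inl h⟩
      · exact ⟨v, hv, Or.inr ⟨u, hu, h⟩⟩

/-- extension of the sample point to all of `Sym2` -/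
def ext2 {n : ℕ} (ω : {e : Sym2 (Fin n) // ¬ e.IsDiag} → Bool) (e : Sym2 (Fin n)) : Bool :=
  if h : ¬ e.IsDiag then ω ⟨e, h⟩ else false

theorem adj_iff {n : ℕ} (ω : {e : Sym2 (Fin n) // ¬ e.IsDiag} → Bool) (u v : Fin n) :
    (graphOf ω).Adj u v ↔ ext2 ω s(u, v) = true := by
  simp only [graphOf, SimpleGraph.fromEdgeSet_adj, Set.mem_ofPred_eq, ext2]
  by_cases h : u = v
  · simp [h]
  · simp [h]

instance gnp_prob (n : ℕ) (p : ℝ) : IsProbabilityMeasure (gnp n p) := by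
  unfold gnp; infer_instance

/-- the effective probability -/
noncomputable def qq (p : ℝ) : ℝ := ((min (Real.toNNReal p) 1 : NNReal) : ℝ)

theorem int_bern (q : NNReal) (h : q ≤ 1) (g : Bool → ℝ) :
    ∫ b, g b ∂((PMF.bernoulli q h).toMeasure) = q * g true + (1 - q) * g false := by
  rw [PMF.integral_eq_sum, Fintype.sum_bool]
  simp [PMF.bernoulli_apply, h]

theorem int_prod {n : ℕ} (p : ℝ) (E : Finset (Sym2 (Fin n))) (hE : ∀ e ∈ E, ¬ e.IsDiag)
    (f : Bool → ℝ) :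
    ∫ ω, ∏ e ∈ E, f (ext2 ω e) ∂(gnp n p) = (qq p * f true + (1 - qq p) * f false) ^ E.card := by
  classical
  have h1 : ∀ ω : {e : Sym2 (Fin n) // ¬ e.IsDiag} → Bool, ∏ e ∈ E, f (ext2 ω e) =
      ∏ e : {e : Sym2 (Fin n) // ¬ e.IsDiag}, (fun b => if e.1 ∈ E then f b else 1) (ω e) := by
    intro ω
    have : E = (Finset.univ.filter (fun e : {e : Sym2 (Fin n) // ¬ e.IsDiag} => e.1 ∈ E)).image
        Subtype.val := by
      ext e
      simp only [Finset.mem_image, Finset.mem_filter, Finset.mem_univ, true_and, Subtype.exists,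
        exists_and_left, exists_prop, exists_eq_right_right]
      exact ⟨fun h => ⟨h, hE e h⟩, fun h => h.1⟩
    conv_lhs => rw [this]
    rw [Finset.prod_image (by intro a _ b _ h; exact Subtype.ext h), Finset.prod_filter]
    refine Finset.prod_congr rfl fun e _ => ?_
    simp [ext2, e.2]
  rw [integral_congr_ae (Filter.Eventually.of_forall h1)]
  unfold gnp
  rw [integral_fintype_prod_eq_prod (𝕜 := ℝ)
    (fun (e : {e : Sym2 (Fin n) // ¬ e.IsDiag}) (b : Bool) => if e.1 ∈ E then f b else 1)]
  have h2 : ∀ e : {e : Sym2 (Fin n) // ¬ e.IsDiag},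
      ∫ b, (fun b => if e.1 ∈ E then f b else 1) b
        ∂((PMF.bernoulli (min (Real.toNNReal p) 1) (min_le_right _ _)).toMeasure) =
      if e.1 ∈ E then (qq p * f true + (1 - qq p) * f false) else 1 := by
    intro e
    rw [int_bern]
    split_ifs
    · rfl
    · ring
  rw [Finset.prod_congr rfl fun e _ => h2 e, Finset.prod_ite, Finset.prod_const_one, mul_one,
    Finset.prod_const]
  congr 1
  rw [← Finset.card_image_of_injective _ (Subtype.val_injective)]
  congr 1
  ext e
  simp only [Finset.mem_image, Finset.mem_filter, Finset.mem_univ, true_and, Subtype.exists]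
  constructor
  · rintro ⟨a, h, h', rfl⟩; exact h'
  · intro h; exact ⟨e, hE e h, h, rfl⟩

theorem int_pairs {n : ℕ} (p : ℝ) (A : Finset (Fin n)) (T : Finset (Fin n × Fin n))
    (hT : ∀ x ∈ T, x.1 ∈ A ∧ x.2 ∉ A) (f : Bool → ℝ) :
    ∫ ω, ∏ x ∈ T, f (ext2 ω s(x.1, x.2)) ∂(gnp n p)
      = (qq p * f true + (1 - qq p) * f false) ^ T.card := by
  classical
  have hinj : Set.InjOn (fun x : Fin n × Fin n => s(x.1, x.2)) (T : Set (Fin n × Fin n)) := by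
    rintro ⟨a, b⟩ hx ⟨c, d⟩ hy h
    have h1 := hT _ hx
    have h2 := hT _ hy
    simp only [Sym2.eq_iff] at h
    rcases h with ⟨rfl, rfl⟩ | ⟨rfl, rfl⟩
    · rfl
    · exact absurd h2.1 h1.2
  have := int_prod p (T.image (fun x : Fin n × Fin n => s(x.1, x.2))) (by
    intro e he
    simp only [Finset.mem_image] at he
    obtain ⟨x, hx, rfl⟩ := he
    have := hT x hx
    intro h
    simp only [Sym2.mk_isDiag_iff] at h
    rw [h] at this
    exact this.2 this.1) f
  rw [Finset.card_image_of_injOn hinj] at this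
  rw [← this]
  congr 1
  ext ω
  rw [Finset.prod_image hinj]

theorem markov {n : ℕ} (p : ℝ) (F : ({e : Sym2 (Fin n) // ¬ e.IsDiag} → Bool) → ℝ)
    (hF : ∀ ω, 0 ≤ F ω) (c : ℝ) (s : Set ({e : Sym2 (Fin n) // ¬ e.IsDiag} → Bool))
    (hs : ∀ ω ∈ s, Real.exp c ≤ F ω) :
    (gnp n p).real s ≤ Real.exp (-c) * ∫ ω, F ω ∂(gnp n p) := by
  have h := mul_meas_ge_le_integral_of_nonneg (μ := gnp n p) (f := F)
    (Filter.Eventually.of_forall hF) Integrable.of_finite (Real.exp c)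
  have h2 : (gnp n p).real s ≤ (gnp n p).real {ω | Real.exp c ≤ F ω} := measureReal_mono hs
  rw [Real.exp_neg, ← div_eq_inv_mul, le_div_iff₀ (Real.exp_pos _), mul_comm]
  exact (mul_le_mul_of_nonneg_left h2 (Real.exp_pos _).le).trans h

theorem qq_nonneg (p : ℝ) : 0 ≤ qq p := NNReal.coe_nonneg _
theorem qq_le_one (p : ℝ) : qq p ≤ 1 := by
  unfold qq; exact_mod_cast min_le_right _ _
theorem qq_eq {p : ℝ} (h0 : 0 ≤ p) (h1 : p ≤ 1) : qq p = p := by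
  unfold qq
  rw [NNReal.coe_min, Real.coe_toNNReal _ h0]
  simpa using h1

/-- MGF bound upper -/
theorem upper_mgf {n : ℕ} (p : ℝ) (A : Finset (Fin n)) (t : ℝ) (ht : 0 ≤ t) (x : ℝ) :
    (gnp n p).real {ω | x < ((cnb (graphOf ω) A).card : ℝ)} ≤
      Real.exp (-(t * (x - A.card))) *
        Real.exp (qq p * (Real.exp t - 1) * (A.card * (n - A.card))) := by
  classical
  have hm := markov p (fun ω => ∏ x ∈ A ×ˢ Aᶜ,
      (fun b : Bool => if b then Real.exp t else 1) (ext2 ω s(x.1, x.2)))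
      (fun ω => Finset.prod_nonneg fun x _ => by
        dsimp only; split_ifs <;> positivity) (t * (x - A.card))
      {ω | x < ((cnb (graphOf ω) A).card : ℝ)} (by
      intro ω hω
      rw [Set.mem_ofPred_eq] at hω
      dsimp only
      rw [Finset.prod_ite, Finset.prod_const_one, mul_one, Finset.prod_const, ← Real.exp_nat_mul]
      apply Real.exp_le_exp.mpr
      rw [mul_comm]
      apply mul_le_mul_of_nonneg_right _ ht
      have : cnb (graphOf ω) A ⊆ A ∪
          ((A ×ˢ Aᶜ).filter (fun x => ext2 ω s(x.1, x.2) = true)).image Prod.snd := by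
        intro w hw
        simp only [cnb, Finset.mem_filter, Finset.mem_univ, true_and, adj_iff] at hw
        simp only [Finset.mem_union, Finset.mem_image, Finset.mem_filter, Finset.mem_product,
          Finset.mem_compl, Prod.exists, exists_eq_right]
        by_cases hwA : w ∈ A
        · exact Or.inl hwA
        · rcases hw with h | ⟨u, hu, h⟩
          · exact absurd h hwA
          · exact Or.inr ⟨u, ⟨hu, hwA⟩, h⟩
      have h1 := (Finset.card_le_card this).trans (Finset.card_union_le _ _)
      have h2 := h1.trans (Nat.add_le_add_left Finset.card_image_le _)
      have h3 : ((cnb (graphOf ω) A).card : ℝ) ≤ A.card +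
        ((A ×ˢ Aᶜ).filter (fun x => ext2 ω s(x.1, x.2) = true)).card := by exact_mod_cast h2
      linarith)
  rw [int_pairs p A (A ×ˢ Aᶜ) (by intro x hx; simpa using hx)
    (fun b : Bool => if b then Real.exp t else 1)] at hm
  refine hm.trans ?_
  apply mul_le_mul_of_nonneg_left _ (Real.exp_pos _).le
  simp only [if_true, Bool.false_eq_true, if_false, Finset.card_product, Finset.card_compl,
    Fintype.card_fin]
  have hA : A.card ≤ n := by simpa using Finset.card_le_univ A
  have h4 : qq p * Real.exp t + (1 - qq p) * 1 ≤ Real.exp (qq p * (Real.exp t - 1)) := by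
    have := Real.add_one_le_exp (qq p * (Real.exp t - 1))
    linarith
  have h5 : 0 ≤ qq p * Real.exp t + (1 - qq p) * 1 := by
    have := qq_nonneg p
    have := qq_le_one p
    have := Real.exp_pos t
    have : 0 ≤ qq p * Real.exp t := by positivity
    linarith
  refine (pow_le_pow_left₀ h5 h4 _).trans ?_
  rw [← Real.exp_nat_mul]
  push_cast [Nat.cast_sub hA]
  rw [mul_comm]

/-- MGF bound lower -/
theorem lower_mgf {n : ℕ} (p : ℝ) (A : Finset (Fin n)) (t : ℝ) (ht : 0 ≤ t) (x : ℝ) :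
    (gnp n p).real {ω | ((cnb (graphOf ω) A).card : ℝ) < x} ≤
      Real.exp (t * x) *
        Real.exp (-((1 - Real.exp (-t)) * (1 - (1 - qq p) ^ A.card) * (n - A.card))) := by
  classical
  have hA : A.card ≤ n := by simpa using Finset.card_le_univ A
  have het : Real.exp (-t) ≤ 1 := Real.exp_le_one_iff.mpr (by linarith)
  have hm := markov p (fun ω => ∏ v ∈ Aᶜ, ((1 - Real.exp (-t)) * (∏ u ∈ A,
      (fun b : Bool => if b then (0:ℝ) else 1) (ext2 ω s(u, v))) + Real.exp (-t)))
      (fun ω => Finset.prod_nonneg fun x _ => by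
        have : 0 ≤ ∏ u ∈ A,  (fun b : Bool => if b then (0:ℝ) else 1) (ext2 ω s(u, x)) :=
          Finset.prod_nonneg fun x _ => by dsimp only; split_ifs <;> positivity
        have := mul_nonneg (sub_nonneg.mpr het) this
        positivity) (-(t * x))
      {ω | ((cnb (graphOf ω) A).card : ℝ) < x} (by
      intro ω hω
      rw [Set.mem_ofPred_eq] at hω
      dsimp only
      have h0 : ∀ v ∈ Aᶜ, (1 - Real.exp (-t)) * (∏ u ∈ A,
          (if ext2 ω s(u, v) = true then (0:ℝ) else 1)) + Real.exp (-t) =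
          if (∃ u ∈ A, ext2 ω s(u, v) = true) then Real.exp (-t) else 1 := by
        intro v _
        split_ifs with h
        · obtain ⟨u, hu, h⟩ := h
          rw [Finset.prod_eq_zero hu (by simp [h])]; ring
        · push Not at h
          rw [Finset.prod_eq_one (by intro u hu; simp [h u hu])]; ring
      rw [Finset.prod_congr rfl h0]
      rw [Finset.prod_ite, Finset.prod_const_one, mul_one, Finset.prod_const, ← Real.exp_nat_mul]
      apply Real.exp_le_exp.mpr
      have : Aᶜ.filter (fun v => ∃ u ∈ A, ext2 ω s(u, v) = true) ⊆ cnb (graphOf ω) A := by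
        intro w hw
        simp only [cnb, Finset.mem_filter, Finset.mem_univ, true_and, adj_iff] at hw ⊢
        exact Or.inr hw.2
      have h3 : ((Aᶜ.filter (fun v => ∃ u ∈ A, ext2 ω s(u, v) = true)).card : ℝ) ≤
        (cnb (graphOf ω) A).card := by exact_mod_cast Finset.card_le_card this
      nlinarith)
  rw [neg_neg] at hm
  refine hm.trans ?_
  apply mul_le_mul_of_nonneg_left _ (Real.exp_pos _).le
  have hint : ∫ ω, ∏ v ∈ Aᶜ, ((1 - Real.exp (-t)) * (∏ u ∈ A,
      (fun b : Bool => if b then (0:ℝ) else 1) (ext2 ω s(u, v))) + Real.exp (-t)) ∂(gnp n p)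
      = ((1 - Real.exp (-t)) * (1 - qq p) ^ A.card + Real.exp (-t)) ^ (Aᶜ).card := by
    simp_rw [Finset.prod_add]
    rw [integral_finsetSum _ (fun _ _ => Integrable.of_finite)]
    rw [← Finset.prod_const, Finset.prod_add]
    refine Finset.sum_congr rfl fun T hT => ?_
    rw [integral_mul_const]
    congr 1
    simp_rw [Finset.prod_mul_distrib]
    rw [integral_const_mul, Finset.prod_const, Finset.prod_const]
    congr 1
    have := int_pairs p A (A ×ˢ T) (by
      intro x hx
      rw [Finset.mem_product] at hx
      exact ⟨hx.1, by simpa using (Finset.mem_powerset.mp hT) hx.2⟩) (fun b : Bool => if b then (0:ℝ) else 1)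
    simp_rw [Finset.prod_product_right] at this
    rw [this, Finset.card_product, pow_mul]
    simp
  rw [hint]
  have h5 : 0 ≤ (1 - Real.exp (-t)) * (1 - qq p) ^ A.card + Real.exp (-t) := by
    have h1 := qq_le_one p
    have : 0 ≤ (1 - qq p) ^ A.card := pow_nonneg (by linarith) _
    have := mul_nonneg (sub_nonneg.mpr het) this
    positivity
  have h4 : (1 - Real.exp (-t)) * (1 - qq p) ^ A.card + Real.exp (-t) ≤
      Real.exp (-((1 - Real.exp (-t)) * (1 - (1 - qq p) ^ A.card))) := by
    have := Real.add_one_le_exp (-((1 - Real.exp (-t)) * (1 - (1 - qq p) ^ A.card)))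
    linarith
  refine (pow_le_pow_left₀ h5 h4 _).trans ?_
  rw [← Real.exp_nat_mul, Finset.card_compl, Fintype.card_fin]
  push_cast [Nat.cast_sub hA]
  apply le_of_eq; congr 1; ring

/-- numeric facts for a fixed small set -/
theorem upper_tail {n : ℕ} (p L : ℝ) (hL : 100 ≤ L) (hn : 100 ≤ (n : ℝ))
    (hd : L ^ 3 ≤ p * ((n : ℝ) - 1)) (hp1 : p ≤ 1) (A : Finset (Fin n)) (hA : A.Nonempty) :
    (gnp n p).real {ω | (1 + 20 / L) * (A.card * (p * ((n : ℝ) - 1))) <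
      ((cnb (graphOf ω) A).card : ℝ)} ≤ Real.exp (-(2 * L)) ^ A.card := by
  have hL0 : 0 < L := by linarith
  refine (upper_mgf p A (4 / L) (by positivity) _).trans ?_
  have ha : (1 : ℝ) ≤ A.card := by exact_mod_cast hA.card_pos
  rw [← Real.exp_add, ← Real.exp_nat_mul]
  apply Real.exp_le_exp.mpr
  have hp0 : 0 ≤ p := by
    by_contra h
    push Not at h
    have : p * ((n : ℝ) - 1) ≤ 0 := mul_nonpos_of_nonpos_of_nonneg h.le (by linarith)
    have : 0 < L ^ 3 := by positivity
    linarith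
  rw [qq_eq hp0 hp1]
  generalize (A.card : ℝ) = a at *
  set d := p * ((n : ℝ) - 1) with hdd
  have hdL : L ≤ d := by
    refine le_trans ?_ hd
    nlinarith [sq_nonneg L, mul_le_mul hL hL (by norm_num) hL0.le]
  set t := 4 / L with ht
  have htL : t * L = 4 := by rw [ht]; field_simp
  have ht0 : 0 < t := by positivity
  have ht1 : t ≤ 1 := by rw [ht, div_le_one hL0]; linarith
  have h20 : 20 / L = 5 * t := by rw [ht]; ring
  rw [h20]
  have he : Real.exp t - 1 ≤ t + t ^ 2 := by
    have := (abs_le.mp (Real.abs_exp_sub_one_sub_id_le (x := t) (by rw [abs_of_pos ht0]; exact ht1))).2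
    linarith
  have he0 : 0 ≤ Real.exp t - 1 := by have := Real.add_one_le_exp t; linarith
  have h1 : p * (Real.exp t - 1) * (a * (n - a)) ≤ (t + t ^ 2) * (a * d) := by
    have e1 : p * (Real.exp t - 1) * (a * (n - a)) ≤ p * (Real.exp t - 1) * (a * (n - 1)) := by
      apply mul_le_mul_of_nonneg_left _ (mul_nonneg hp0 he0)
      apply mul_le_mul_of_nonneg_left _ (by linarith)
      linarith
    have e2 : p * (Real.exp t - 1) * (a * (n - 1)) = (Real.exp t - 1) * (a * d) := by
      rw [hdd]; ring
    rw [e2] at e1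
    refine e1.trans (mul_le_mul_of_nonneg_right he ?_)
    apply mul_nonneg <;> linarith
  have had : 4 * a ≤ t * (a * d) := by
    have : t * (a * L) ≤ t * (a * d) := by gcongr
    calc 4 * a = t * (a * L) := by rw [← htL]; ring
      _ ≤ _ := this
  have hbig : 2 * (a * L) ≤ t ^ 2 * (a * d) := by
    have : t ^ 2 * (a * L ^ 3) ≤ t ^ 2 * (a * d) := by gcongr
    have e : t ^ 2 * (a * L ^ 3) = 16 * (a * L) := by
      calc _ = (t * L) ^ 2 * (a * L) := by ring
        _ = _ := by rw [htL]; norm_num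
    have : 0 < a * L := by positivity
    linarith
  have hta : 4 * (t * a) ≤ t ^ 2 * (a * d) := by
    have := mul_le_mul_of_nonneg_left had ht0.le
    nlinarith
  nlinarith

theorem lower_tail {n : ℕ} (p L : ℝ) (hL : 100 ≤ L) (hn : 100 ≤ (n : ℝ))
    (hd : L ^ 3 ≤ p * ((n : ℝ) - 1)) (hp1 : p ≤ 1) (A : Finset (Fin n)) (hA : A.Nonempty)
    (hAd : (A.card : ℝ) * (p * ((n : ℝ) - 1)) ≤ 2 * n / L) :
    (gnp n p).real {ω | ((cnb (graphOf ω) A).card : ℝ) <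
      (1 - 20 / L) * (A.card * (p * ((n : ℝ) - 1)))} ≤ Real.exp (-(2 * L)) ^ A.card := by
  have hL0 : 0 < L := by linarith
  refine (lower_mgf p A (4 / L) (by positivity) _).trans ?_
  have ha : (1 : ℝ) ≤ A.card := by exact_mod_cast hA.card_pos
  have hAn : (A.card : ℝ) ≤ n := by exact_mod_cast (by simpa using Finset.card_le_univ A)
  rw [← Real.exp_add, ← Real.exp_nat_mul]
  apply Real.exp_le_exp.mpr
  have hp0 : 0 ≤ p := by
    by_contra h
    push Not at h
    have : p * ((n : ℝ) - 1) ≤ 0 := mul_nonpos_of_nonpos_of_nonneg h.le (by linarith)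
    have : 0 < L ^ 3 := by positivity
    linarith
  rw [qq_eq hp0 hp1]
  have hpow : (1 - p) ^ A.card ≤ Real.exp (-(A.card * p)) := by
    have := Real.add_one_le_exp (-p)
    refine (pow_le_pow_left₀ (by linarith) (by linarith : 1 - p ≤ Real.exp (-p)) _).trans ?_
    rw [← Real.exp_nat_mul]
    apply le_of_eq; congr 1; ring
  generalize (1 - p) ^ A.card = w at *
  generalize (A.card : ℝ) = a at *
  set d := p * ((n : ℝ) - 1) with hdd
  have hdL : L ≤ d := by
    refine le_trans ?_ hd
    nlinarith [sq_nonneg L, mul_le_mul hL hL (by norm_num) hL0.le]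
  set t := 4 / L with ht
  have htL : t * L = 4 := by rw [ht]; field_simp
  have ht0 : 0 < t := by positivity
  have ht1 : t ≤ 1 / 25 := by rw [ht, div_le_div_iff₀ hL0 (by norm_num)]; linarith
  have h20 : 20 / L = 5 * t := by rw [ht]; ring
  rw [h20]
  have h2n : 2 * n / L = t * n / 2 := by rw [ht]; ring
  rw [h2n] at hAd
  have hap0 : 0 ≤ a * p := mul_nonneg (by linarith) hp0
  have hap : a * p ≤ t := by
    have h3 : a * p * (n - 1) ≤ t * (n - 1) := by
      have : a * p * (n - 1) = a * d := by rw [hdd]; ring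
      rw [this]
      refine hAd.trans ?_
      nlinarith
    exact le_of_mul_le_mul_right h3 (by linarith)
  have hw : a * p * (1 - t) ≤ 1 - w := by
    have := (abs_le.mp (Real.abs_exp_sub_one_sub_id_le (x := -(a * p))
      (by rw [abs_neg, abs_of_nonneg hap0]; linarith))).2
    nlinarith
  have he : t - t ^ 2 ≤ 1 - Real.exp (-t) := by
    have := (abs_le.mp (Real.abs_exp_sub_one_sub_id_le (x := -t)
      (by rw [abs_neg, abs_of_nonneg ht0.le]; linarith))).2
    nlinarith
  have had : 4 * a ≤ t * (a * d) := by
    have : t * (a * L) ≤ t * (a * d) := by gcongr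
    calc 4 * a = t * (a * L) := by rw [← htL]; ring
      _ ≤ _ := this
  have han : a ≤ t * n := by nlinarith
  have hna : (n - 1) * (1 - 2 * t) ≤ n - a := by nlinarith
  have hD : 0 < a * d := by apply mul_pos <;> linarith
  have h1 : (t - t ^ 2) * (a * p * (1 - t)) * ((n - 1) * (1 - 2 * t)) ≤
      (1 - Real.exp (-t)) * (1 - w) * (n - a) := by
    have q1 : 0 ≤ t - t ^ 2 := by nlinarith
    have q2 : 0 ≤ a * p * (1 - t) := mul_nonneg hap0 (by linarith)
    have q3 : 0 ≤ ((n : ℝ) - 1) * (1 - 2 * t) := mul_nonneg (by linarith) (by linarith)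
    apply mul_le_mul (mul_le_mul he hw q2 (q1.trans he)) hna q3
    exact mul_nonneg (q1.trans he) (q2.trans hw)
  have h2 : (t - t ^ 2) * (a * p * (1 - t)) * ((n - 1) * (1 - 2 * t)) =
      t * (a * d) * ((1 - t) ^ 2 * (1 - 2 * t)) := by rw [hdd]; ring
  have h3 : 1 - 4 * t ≤ (1 - t) ^ 2 * (1 - 2 * t) := by nlinarith [pow_pos ht0 2, pow_pos ht0 3]
  have h4 : t * (a * d) * (1 - 4 * t) ≤ t * (a * d) * ((1 - t) ^ 2 * (1 - 2 * t)) :=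
    mul_le_mul_of_nonneg_left h3 (by positivity)
  have hbig : 2 * (a * L) ≤ t ^ 2 * (a * d) := by
    have : t ^ 2 * (a * L ^ 3) ≤ t ^ 2 * (a * d) := by gcongr
    have e : t ^ 2 * (a * L ^ 3) = 16 * (a * L) := by
      calc _ = (t * L) ^ 2 * (a * L) := by ring
        _ = _ := by rw [htL]; norm_num
    have : 0 < a * L := by positivity
    linarith
  nlinarith

/-- the deterministic one-step event -/
def goodStep {n : ℕ} (d L : ℝ) (G : SimpleGraph (Fin n)) : Prop :=
  ∀ A : Finset (Fin n), A.Nonempty → (A.card : ℝ) * d ≤ 2 * n / L →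
    (1 - 20 / L) * (A.card * d) ≤ ((cnb G A).card : ℝ) ∧
    ((cnb G A).card : ℝ) ≤ (1 + 20 / L) * (A.card * d)

theorem bad_prob {n : ℕ} (p L : ℝ) (hL : 100 ≤ L) (hn : 100 ≤ (n : ℝ))
    (hd : L ^ 3 ≤ p * ((n : ℝ) - 1)) :
    (gnp n p).real {ω | ¬ goodStep (p * ((n : ℝ) - 1)) L (graphOf ω)} ≤
      2 * (Real.exp (n * Real.exp (-(2 * L))) - 1) := by
  classical
  have hL0 : 0 < L := by linarith
  set d := p * ((n : ℝ) - 1) with hdd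
  set x := Real.exp (-(2 * L)) with hx
  have hx0 : 0 < x := Real.exp_pos _
  set 𝒜 : Finset (Finset (Fin n)) := Finset.univ.filter
    (fun A => A.Nonempty ∧ (A.card : ℝ) * d ≤ 2 * n / L) with h𝒜
  have hsub : {ω | ¬ goodStep d L (graphOf ω)} ⊆ ⋃ A ∈ 𝒜,
      ({ω | (1 + 20 / L) * (A.card * d) < ((cnb (graphOf ω) A).card : ℝ)} ∪
       {ω | ((cnb (graphOf ω) A).card : ℝ) < (1 - 20 / L) * (A.card * d)}) := by
    intro ω hω
    simp only [goodStep, Set.mem_ofPred_eq] at hω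
    push Not at hω
    obtain ⟨A, hA, hAd, h⟩ := hω
    simp only [Set.mem_iUnion, Set.mem_union, Set.mem_ofPred_eq, h𝒜, Finset.mem_filter,
      Finset.mem_univ, true_and, exists_prop]
    refine ⟨A, ⟨hA, hAd⟩, ?_⟩
    by_cases h1 : (1 - 20 / L) * (A.card * d) ≤ ((cnb (graphOf ω) A).card : ℝ)
    · exact Or.inl (h h1)
    · exact Or.inr (not_le.mp h1)
  refine (measureReal_mono hsub (measure_ne_top _ _)).trans ?_
  refine (measureReal_biUnion_finset_le _ _).trans ?_
  have hterm : ∀ A ∈ 𝒜, (gnp n p).real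
      ({ω | (1 + 20 / L) * (A.card * d) < ((cnb (graphOf ω) A).card : ℝ)} ∪
       {ω | ((cnb (graphOf ω) A).card : ℝ) < (1 - 20 / L) * (A.card * d)}) ≤ 2 * x ^ A.card := by
    intro A hA
    simp only [h𝒜, Finset.mem_filter, Finset.mem_univ, true_and] at hA
    obtain ⟨hA, hAd⟩ := hA
    have ha : (1 : ℝ) ≤ A.card := by exact_mod_cast hA.card_pos
    have hd0 : 0 < d := lt_of_lt_of_le (by positivity) hd
    have hp1 : p ≤ 1 := by
      have h1 : d ≤ 2 * n / L := le_trans (by nlinarith) hAd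
      have h2 : 2 * n / L ≤ 1 * ((n : ℝ) - 1) := by
        rw [div_le_iff₀ hL0]; nlinarith
      exact le_of_mul_le_mul_right (h1.trans h2) (by linarith)
    have h1 := upper_tail p L hL hn hd hp1 A hA
    have h2 := lower_tail p L hL hn hd hp1 A hA hAd
    refine (measureReal_union_le _ _).trans ?_
    linarith
  refine (Finset.sum_le_sum hterm).trans ?_
  rw [← Finset.mul_sum]
  apply mul_le_mul_of_nonneg_left _ (by norm_num)
  have hs : 𝒜 ⊆ Finset.univ.erase ∅ := by
    intro A hA
    simp only [h𝒜, Finset.mem_filter, Finset.mem_univ, true_and] at hA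
    simp [hA.1.ne_empty]
  refine (Finset.sum_le_sum_of_subset_of_nonneg hs (fun _ _ _ => by positivity)).trans ?_
  have htot : ∑ A : Finset (Fin n), x ^ A.card = (x + 1) ^ n := by
    have := Fintype.sum_pow_mul_eq_add_pow (Fin n) x 1
    simpa using this
  have h3 := Finset.add_sum_erase Finset.univ (fun A : Finset (Fin n) => x ^ A.card)
    (Finset.mem_univ ∅)
  simp only [Finset.card_empty, pow_zero] at h3
  rw [htot] at h3
  have h4 : (x + 1) ^ n ≤ Real.exp (n * x) := by
    rw [Real.exp_nat_mul]
    exact pow_le_pow_left₀ (by positivity) (Real.add_one_le_exp x) n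
  linarith

theorem iterate_good {n : ℕ} (d L η : ℝ) (hL : 100 ≤ L) (hLn : L = Real.log n)
    (hn : 100 ≤ (n : ℝ)) (hd : L ^ 3 ≤ d) (hη0 : 0 < η) (hη1 : η < 1)
    (hLη : 20 ≤ η / 2 * Real.log L)
    (G : SimpleGraph (Fin n)) (hG : goodStep d L G) (S : Finset (Fin n)) (hS : S.Nonempty)
    (r : ℕ) (hr : (S.card : ℝ) * d ^ r < n / L) :
    (1 - η) * (S.card * d ^ r) ≤ (((cnb G)^[r] S).card : ℝ) ∧
    (((cnb G)^[r] S).card : ℝ) ≤ (1 + η) * (S.card * d ^ r) := by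
  have hL0 : 0 < L := by linarith
  have hs : (1 : ℝ) ≤ S.card := by exact_mod_cast hS.card_pos
  have hd1 : 1 ≤ d := by
    refine le_trans ?_ hd
    exact one_le_pow₀ (by linarith)
  have hd0 : 0 < d := by linarith
  have hlogL : 0 < Real.log L := Real.log_pos (by linarith)
  -- bound on r
  have hrL : r * Real.log L ≤ L := by
    have h1 : d ^ r ≤ n := by
      have : d ^ r ≤ S.card * d ^ r := le_mul_of_one_le_left (by positivity) hs
      have : (n : ℝ) / L ≤ n := div_le_self (by linarith) (by linarith)
      linarith
    have h2 := Real.log_le_log (by positivity) h1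
    rw [Real.log_pow, ← hLn] at h2
    have h3 : Real.log L ≤ Real.log d := by
      apply Real.log_le_log hL0
      refine le_trans ?_ hd
      exact le_self_pow₀ (by linarith) (by norm_num)
    have : r * Real.log L ≤ r * Real.log d := by gcongr
    linarith
  set ε := 20 / L with hε
  have hε0 : 0 < ε := by positivity
  have hε1 : ε ≤ 1 / 5 := by rw [hε, div_le_div_iff₀ hL0 (by norm_num)]; linarith
  have hrε : r * ε ≤ η / 2 := by
    rw [hε, mul_div_assoc', div_le_iff₀ hL0]
    have : (r : ℝ) * 20 ≤ r * (η / 2 * Real.log L) := by gcongr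
    nlinarith
  have hup : (1 + ε) ^ r ≤ 1 + η := by
    have h1 : (1 + ε) ^ r ≤ Real.exp (r * ε) := by
      rw [Real.exp_nat_mul]
      exact pow_le_pow_left₀ (by positivity) (by linarith [Real.add_one_le_exp ε]) r
    have h2 : Real.exp (r * ε) ≤ Real.exp (η / 2) := Real.exp_le_exp.mpr hrε
    have h3 := (abs_le.mp (Real.abs_exp_sub_one_sub_id_le (x := η / 2)
      (by rw [abs_of_pos (by linarith)]; linarith))).2
    nlinarith
  have hlo : 1 - η ≤ (1 - ε) ^ r := by
    have := one_add_mul_le_pow (a := -ε) (by linarith) r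
    have e : (1 + -ε) = 1 - ε := by ring
    rw [e] at this
    nlinarith
  have key : ∀ k : ℕ, k ≤ r → (1 - ε) ^ k * (S.card * d ^ k) ≤ (((cnb G)^[k] S).card : ℝ) ∧
      (((cnb G)^[k] S).card : ℝ) ≤ (1 + ε) ^ k * (S.card * d ^ k) := by
    intro k
    induction k with
    | zero => intro _; simp
    | succ k ih =>
      intro hk
      obtain ⟨i1, i2⟩ := ih (by omega)
      rw [Function.iterate_succ_apply']
      set B := (cnb G)^[k] S with hB
      have hBpos : (0 : ℝ) < B.card := by
        refine lt_of_lt_of_le ?_ i1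
        have : 0 < 1 - ε := by linarith
        positivity
      have hBne : B.Nonempty := Finset.card_pos.mp (by exact_mod_cast hBpos)
      have hBd : (B.card : ℝ) * d ≤ 2 * n / L := by
        have e1 : (1 + ε) ^ k ≤ 2 := by
          have : (1 + ε) ^ k ≤ (1 + ε) ^ r := pow_le_pow_right₀ (by linarith) (by omega)
          linarith
        have e2 : d ^ (k + 1) ≤ d ^ r := pow_le_pow_right₀ hd1 hk
        calc (B.card : ℝ) * d ≤ ((1 + ε) ^ k * (S.card * d ^ k)) * d := by gcongr
          _ = (1 + ε) ^ k * (S.card * d ^ (k + 1)) := by ring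
          _ ≤ 2 * (S.card * d ^ r) := by gcongr
          _ ≤ 2 * (n / L) := by gcongr
          _ = _ := by ring
      obtain ⟨g1, g2⟩ := hG B hBne hBd
      constructor
      · refine le_trans ?_ g1
        calc (1 - ε) ^ (k + 1) * (S.card * d ^ (k + 1))
            = (1 - ε) * (((1 - ε) ^ k * (S.card * d ^ k)) * d) := by ring
          _ ≤ _ := by
            apply mul_le_mul_of_nonneg_left _ (by linarith)
            gcongr
      · refine le_trans g2 ?_
        calc _ ≤ (1 + ε) * (((1 + ε) ^ k * (S.card * d ^ k)) * d) := by gcongr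
          _ = _ := by ring
  obtain ⟨k1, k2⟩ := key r le_rfl
  have hpos : 0 ≤ (S.card : ℝ) * d ^ r := by positivity
  exact ⟨(mul_le_mul_of_nonneg_right hlo hpos).trans k1,
    k2.trans (mul_le_mul_of_nonneg_right hup hpos)⟩

/-- If `d = p(n-1) ≥ log³ n`, then for every `η ∈ (0,1)`, a.a.s. in
`G(n,p)`: for every nonempty `S ⊆ [n]` with `|S| = s` and every `r : ℕ` with
`s d^r < n / log n`, `(1-η) s d^r ≤ |⋃_{v ∈ S} N(v,r)| ≤ (1+η) s d^r`. -/
theorem stmt_9 (p : ℕ → ℝ)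
    (hd : ∀ n : ℕ, 2 ≤ n → (Real.log n) ^ 3 ≤ p n * ((n : ℝ) - 1))
    (η : ℝ) (hη0 : 0 < η) (hη1 : η < 1) :
    Filter.Tendsto (fun n : ℕ =>
        gnp n (p n) {ω | ∀ S : Finset (Fin n), S.Nonempty → ∀ r : ℕ,
          (S.card : ℝ) * (p n * ((n : ℝ) - 1)) ^ r < (n : ℝ) / Real.log n →
          (1 - η) * ((S.card : ℝ) * (p n * ((n : ℝ) - 1)) ^ r)
              ≤ ((⋃ v ∈ S, ball (graphOf ω) v r).ncard : ℝ) ∧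
          ((⋃ v ∈ S, ball (graphOf ω) v r).ncard : ℝ)
              ≤ (1 + η) * ((S.card : ℝ) * (p n * ((n : ℝ) - 1)) ^ r)})
      Filter.atTop (nhds 1) := by
  have hlog : Filter.Tendsto (fun n : ℕ => Real.log (n : ℝ)) Filter.atTop Filter.atTop :=
    Real.tendsto_log_atTop.comp tendsto_natCast_atTop_atTop
  have hloglog : Filter.Tendsto (fun n : ℕ => η / 2 * Real.log (Real.log (n : ℝ)))
      Filter.atTop Filter.atTop :=
    (Real.tendsto_log_atTop.comp hlog).const_mul_atTop (by positivity)
  have hlim : Filter.Tendsto (fun n : ℕ => 1 - 2 * (Real.exp ((n : ℝ)⁻¹) - 1))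
      Filter.atTop (nhds (1 - 2 * (Real.exp 0 - 1))) := by
    have h0 : Filter.Tendsto (fun n : ℕ => ((n : ℝ))⁻¹) Filter.atTop (nhds 0) :=
      tendsto_inv_atTop_nhds_zero_nat
    exact ((((Real.continuous_exp.tendsto 0).comp h0).sub_const 1).const_mul 2).const_sub 1
  rw [Real.exp_zero, sub_self, mul_zero, sub_zero] at hlim
  have hlim2 := ENNReal.tendsto_ofReal hlim
  rw [ENNReal.ofReal_one] at hlim2
  refine tendsto_of_tendsto_of_tendsto_of_le_of_le' hlim2 tendsto_const_nhds ?_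
    (Filter.Eventually.of_forall fun n => prob_le_one)
  filter_upwards [hlog.eventually_ge_atTop 100, hloglog.eventually_ge_atTop 20,
    Filter.eventually_ge_atTop 100] with n h1 h2 h3
  have hn : (100 : ℝ) ≤ n := by exact_mod_cast h3
  have hd' := hd n (by omega)
  have hbad := bad_prob (p n) (Real.log n) h1 hn hd'
  have hsub : {ω | goodStep (p n * ((n : ℝ) - 1)) (Real.log n) (graphOf ω)} ⊆
      {ω | ∀ S : Finset (Fin n), S.Nonempty → ∀ r : ℕ,
          (S.card : ℝ) * (p n * ((n : ℝ) - 1)) ^ r < (n : ℝ) / Real.log n →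
          (1 - η) * ((S.card : ℝ) * (p n * ((n : ℝ) - 1)) ^ r)
              ≤ ((⋃ v ∈ S, ball (graphOf ω) v r).ncard : ℝ) ∧
          ((⋃ v ∈ S, ball (graphOf ω) v r).ncard : ℝ)
              ≤ (1 + η) * ((S.card : ℝ) * (p n * ((n : ℝ) - 1)) ^ r)} := by
    intro ω hω S hS r hr
    rw [union_ball, Set.ncard_coe_finset]
    exact iterate_good _ _ η h1 rfl hn hd' hη0 hη1 h2 _ hω S hS r hr
  refine le_trans ?_ (measure_mono hsub)
  rw [← ofReal_measureReal]
  apply ENNReal.ofReal_le_ofReal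
  have hx : (n : ℝ) * Real.exp (-(2 * Real.log n)) = (n : ℝ)⁻¹ := by
    have hn0 : (0 : ℝ) < n := by linarith
    rw [Real.exp_neg, two_mul, Real.exp_add, Real.exp_log hn0]
    field_simp
  rw [hx] at hbad
  have hc := probReal_compl_eq_one_sub (μ := gnp n (p n))
    (s := {ω | goodStep (p n * ((n : ℝ) - 1)) (Real.log n) (graphOf ω)})
    (Set.toFinite _).measurableSet
  have he : {ω : {e : Sym2 (Fin n) // ¬ e.IsDiag} → Bool | goodStep (p n * ((n : ℝ) - 1)) (Real.log n) (graphOf ω)}ᶜ =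
      {ω | ¬ goodStep (p n * ((n : ℝ) - 1)) (Real.log n) (graphOf ω)} := rfl
  rw [he] at hc
  linarith
end
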